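/- Let L₁, L₂, L₃ be affine lines in ℝ² with pairwise distinct directions, all passing through a common point p₀. Let p₁, p₂, p₃ : ℝ → ℝ² be continuous maps with pᵢ(t) ∈ Lᵢ for all t, all pairwise distances dist(pᵢ(t), pⱼ(t)) = dᵢⱼ constant in t and positive, p₁(0), p₂(0), p₃(0) not collinear, and the motion nonconstant. Let α₁₂ ∈ (0, π) be the angle between direction vectors of L₁ and L₂. Then for every t, the four points p₀, p₁(t), p₂(t), p₃(t) lie on a common circle of radius r = d₁₂ / (2 sin α₁₂); in particular the circumradius of the triangle p₁(t)p₂(t)p₃(t) is constant in t and its circumcircle passes through p₀ for all t. -/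

import Mathlib

/-- `L` is an affine line: a nonempty affine subspace whose direction has dimension 1. -/
def IsAffineLine {n : ℕ} (L : AffineSubspace ℝ (EuclideanSpace ℝ (Fin n))) : Prop :=
  (L : Set (EuclideanSpace ℝ (Fin n))).Nonempty ∧ Module.finrank ℝ L.direction = 1

/-- A continuous real function whose square is constant is itself constant. -/
theorem Continuous.eq_of_sq_const {f : ℝ → ℝ} (hf : Continuous f)
    (h : ∀ t, f t ^ 2 = f 0 ^ 2) (t : ℝ) : f t = f 0 := by
  by_cases h0 : f 0 = 0
  · have := h t
    rw [h0] at this ⊢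
    simpa using this
  · exact isPreconnected_univ.eq_of_sq_eq (S := Set.univ) (f := f) (g := fun _ => f 0)
      hf.continuousOn continuousOn_const (fun x _ => h x) (fun {_} _ => h0)
      (Set.mem_univ 0) rfl (Set.mem_univ t)

/-- A continuous planar vector function of constant length, orthogonal to a fixed nonzero vector,
is constant. -/
theorem planar_const_of_orthogonal {u w : ℝ → ℝ} (hu : Continuous u) (hw : Continuous w)
    (hn : ∀ t, u t ^ 2 + w t ^ 2 = u 0 ^ 2 + w 0 ^ 2) {g k : ℝ} (hg : g ^ 2 + k ^ 2 ≠ 0)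
    (ho : ∀ t, g * u t + k * w t = 0) (t : ℝ) : u t = u 0 ∧ w t = w 0 := by
  have hc : Continuous fun t => g * w t - k * u t := by fun_prop
  have h := hc.eq_of_sq_const (fun t => by
    linear_combination (g ^ 2 + k ^ 2) * hn t - (g * u t + k * w t) * ho t
      + (g * u 0 + k * w 0) * ho 0) t
  constructor
  · apply mul_left_cancel₀ hg
    linear_combination g * ho t - g * ho 0 - k * h
  · apply mul_left_cancel₀ hg
    linear_combination k * ho t - k * ho 0 + g * h

/-- Let `e = s₁ v₁ - s₀ v₀`. If the point `s₀ v₀ + l e + m J e`, with `J` the quarter turn, lies on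
the line spanned by `v₂` for all `s₀`, `s₁`, then it lies on the circle through `0`, `s₀ v₀`,
`s₁ v₁`. -/
theorem coupler_point_on_circle {a₀ b₀ a₁ b₁ a₂ b₂ l m : ℝ} (hD : a₀ * b₁ - b₀ * a₁ ≠ 0)
    (hv : a₂ ^ 2 + b₂ ^ 2 ≠ 0)
    (h₁ : -b₁ * (a₀ * b₂ - b₀ * a₂) + (a₀ * b₁ - b₀ * a₁) * (l * b₂ - m * a₂) = 0)
    (h₂ : a₁ * (a₀ * b₂ - b₀ * a₂) + (a₀ * b₁ - b₀ * a₁) * (-l * a₂ - m * b₂) = 0)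
    (s₀ s₁ : ℝ) {e f x y X Y : ℝ} (he : e = s₁ * a₁ - s₀ * a₀) (hf : f = s₁ * b₁ - s₀ * b₀)
    (hx : x = s₀ * a₀ + l * e - m * f) (hy : y = s₀ * b₀ + l * f + m * e)
    (hX : (a₀ * b₁ - b₀ * a₁) * X = s₀ * (a₀ ^ 2 + b₀ ^ 2) * b₁ - s₁ * (a₁ ^ 2 + b₁ ^ 2) * b₀)
    (hY : (a₀ * b₁ - b₀ * a₁) * Y = s₁ * (a₁ ^ 2 + b₁ ^ 2) * a₀ - s₀ * (a₀ ^ 2 + b₀ ^ 2) * a₁) :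
    x ^ 2 + y ^ 2 = X * x + Y * y := by
  have hm : m = (a₀ * b₂ - b₀ * a₂) * (a₁ * b₂ - b₁ * a₂) /
      ((a₀ * b₁ - b₀ * a₁) * (a₂ ^ 2 + b₂ ^ 2)) := by
    rw [eq_div_iff (mul_ne_zero hD hv)]
    linear_combination -a₂ * h₁ - b₂ * h₂
  have hl : l = (a₀ * b₂ - b₀ * a₂) * (b₁ * b₂ + a₁ * a₂) /
      ((a₀ * b₁ - b₀ * a₁) * (a₂ ^ 2 + b₂ ^ 2)) := by
    rw [eq_div_iff (mul_ne_zero hD hv)]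
    linear_combination b₂ * h₁ - a₂ * h₂
  rw [mul_comm, ← eq_div_iff hD] at hX hY
  subst he hf
  subst hX hY hx hy
  subst hm hl
  field_simp
  ring

/-- Coordinate form of the theorem on a triangle moving on three lines through the origin:
a nonconstant motion keeps the third vertex on the circle through the origin and the other two. -/
theorem moving_triangle_on_circle {a b : Fin 3 → ℝ} {s : Fin 3 → ℝ → ℝ}
    (hs : ∀ i, Continuous (s i)) (hD : a 0 * b 1 - b 0 * a 1 ≠ 0)
    (hv : ∀ i, a i ^ 2 + b i ^ 2 ≠ 0)
    (hrigid : ∀ i j t, (s i t * a i - s j t * a j) ^ 2 + (s i t * b i - s j t * b j) ^ 2 =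
      (s i 0 * a i - s j 0 * a j) ^ 2 + (s i 0 * b i - s j 0 * b j) ^ 2)
    (hpos : (s 1 0 * a 1 - s 0 0 * a 0) ^ 2 + (s 1 0 * b 1 - s 0 0 * b 0) ^ 2 ≠ 0)
    (hmove : ∃ i t, s i t ≠ s i 0) (t : ℝ) {X Y : ℝ}
    (hX : (a 0 * b 1 - b 0 * a 1) * X =
      s 0 t * (a 0 ^ 2 + b 0 ^ 2) * b 1 - s 1 t * (a 1 ^ 2 + b 1 ^ 2) * b 0)
    (hY : (a 0 * b 1 - b 0 * a 1) * Y =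
      s 1 t * (a 1 ^ 2 + b 1 ^ 2) * a 0 - s 0 t * (a 0 ^ 2 + b 0 ^ 2) * a 1) :
    (s 2 t * a 2) ^ 2 + (s 2 t * b 2) ^ 2 = X * (s 2 t * a 2) + Y * (s 2 t * b 2) := by
  have hs0 := hs 0
  have hs1 := hs 1
  have hs2 := hs 2
  obtain ⟨e, he⟩ : ∃ e : ℝ → ℝ, ∀ t, e t = s 1 t * a 1 - s 0 t * a 0 := ⟨_, fun _ => rfl⟩
  obtain ⟨f, hf⟩ : ∃ f : ℝ → ℝ, ∀ t, f t = s 1 t * b 1 - s 0 t * b 0 := ⟨_, fun _ => rfl⟩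
  obtain ⟨x, hx⟩ : ∃ x : ℝ → ℝ, ∀ t, x t = s 2 t * a 2 - s 0 t * a 0 := ⟨_, fun _ => rfl⟩
  obtain ⟨y, hy⟩ : ∃ y : ℝ → ℝ, ∀ t, y t = s 2 t * b 2 - s 0 t * b 0 := ⟨_, fun _ => rfl⟩
  have hec : Continuous e := by rw [funext he]; fun_prop
  have hfc : Continuous f := by rw [funext hf]; fun_prop
  have hxc : Continuous x := by rw [funext hx]; fun_prop
  have hyc : Continuous y := by rw [funext hy]; fun_prop
  have hef : ∀ t, e t ^ 2 + f t ^ 2 = e 0 ^ 2 + f 0 ^ 2 := fun t => by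
    simpa only [he, hf] using hrigid 1 0 t
  have hxy : ∀ t, x t ^ 2 + y t ^ 2 = x 0 ^ 2 + y 0 ^ 2 := fun t => by
    simpa only [hx, hy] using hrigid 2 0 t
  have hxe : ∀ t, (x t - e t) ^ 2 + (y t - f t) ^ 2 = (x 0 - e 0) ^ 2 + (y 0 - f 0) ^ 2 :=
    fun t => by
      have := hrigid 2 1 t
      simp only [he, hf, hx, hy]
      linear_combination this
  have hd : e 0 ^ 2 + f 0 ^ 2 ≠ 0 := by rwa [he, hf]
  have hdot : ∀ t, x t * e t + y t * f t = x 0 * e 0 + y 0 * f 0 := fun t => by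
    linear_combination (hef t + hxy t - hxe t) / 2
  have hcross : ∀ t, e t * y t - f t * x t = e 0 * y 0 - f 0 * x 0 := by
    have hc : Continuous fun t => e t * y t - f t * x t := by fun_prop
    refine hc.eq_of_sq_const fun t => ?_
    linear_combination (x t ^ 2 + y t ^ 2) * hef t + (e 0 ^ 2 + f 0 ^ 2) * hxy t
      - (x t * e t + y t * f t + x 0 * e 0 + y 0 * f 0) * hdot t
  obtain ⟨l, hl⟩ : ∃ l, l * (e 0 ^ 2 + f 0 ^ 2) = x 0 * e 0 + y 0 * f 0 :=
    ⟨_, div_mul_cancel₀ _ hd⟩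
  obtain ⟨m, hm⟩ : ∃ m, m * (e 0 ^ 2 + f 0 ^ 2) = e 0 * y 0 - f 0 * x 0 :=
    ⟨_, div_mul_cancel₀ _ hd⟩
  have hxlm : ∀ t, x t = l * e t - m * f t := fun t => by
    apply mul_left_cancel₀ hd
    linear_combination -e t * hl + f t * hm - x t * hef t + e t * hdot t - f t * hcross t
  have hylm : ∀ t, y t = l * f t + m * e t := fun t => by
    apply mul_left_cancel₀ hd
    linear_combination -f t * hl - e t * hm - y t * hef t + f t * hdot t + e t * hcross t
  obtain ⟨g, hg⟩ : ∃ g, g = -b 1 * (a 0 * b 2 - b 0 * a 2) +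
    (a 0 * b 1 - b 0 * a 1) * (l * b 2 - m * a 2) := ⟨_, rfl⟩
  obtain ⟨k, hk⟩ : ∃ k, k = a 1 * (a 0 * b 2 - b 0 * a 2) +
    (a 0 * b 1 - b 0 * a 1) * (-l * a 2 - m * b 2) := ⟨_, rfl⟩
  have ho : ∀ t, g * e t + k * f t = 0 := fun t => by
    have hx2 := hx t
    have hy2 := hy t
    rw [hxlm] at hx2
    rw [hylm] at hy2
    rw [hg, hk]
    have h1 := he t
    have h2 := hf t
    linear_combination (a 0 * b 1 - b 0 * a 1) * (b 2 * hx2 - a 2 * hy2) -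
      (a 0 * b 2 - b 0 * a 2) * (b 1 * h1 - a 1 * h2)
  have hgk : g ^ 2 + k ^ 2 = 0 := by
    by_contra hne
    have hc := planar_const_of_orthogonal hec hfc hef hne ho
    have hc0 : ∀ t, s 0 t = s 0 0 := fun t => by
      obtain ⟨h1, h2⟩ := hc t
      rw [he, he] at h1
      rw [hf, hf] at h2
      apply mul_left_cancel₀ hD
      linear_combination -b 1 * h1 + a 1 * h2
    have hc1 : ∀ t, s 1 t = s 1 0 := fun t => by
      obtain ⟨h1, h2⟩ := hc t
      rw [he, he] at h1
      rw [hf, hf] at h2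
      apply mul_left_cancel₀ hD
      linear_combination -b 0 * h1 + a 0 * h2
    have hc2 : ∀ t, s 2 t = s 2 0 := fun t => by
      obtain ⟨h1, h2⟩ := hc t
      have h3 := hx t
      have h4 := hy t
      rw [hxlm, h1, h2, ← hxlm, hx, hc0 t] at h3
      rw [hylm, h1, h2, ← hylm, hy, hc0 t] at h4
      apply mul_left_cancel₀ (hv 2)
      linear_combination -a 2 * h3 - b 2 * h4
    obtain ⟨i, t, h⟩ := hmove
    fin_cases i
    · exact h (hc0 t)
    · exact h (hc1 t)
    · exact h (hc2 t)
  have hg0 : g = 0 := by nlinarith [sq_nonneg g, sq_nonneg k]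
  have hk0 : k = 0 := by nlinarith [sq_nonneg g, sq_nonneg k]
  refine coupler_point_on_circle hD (hv 2) (hg.symm.trans hg0) (hk.symm.trans hk0)
    (s 0 t) (s 1 t) (he t) (hf t) ?_ ?_ hX hY
  · linear_combination hxlm t - hx t
  · linear_combination hylm t - hy t

theorem EuclideanSpace.norm_sq_fin_two (x : EuclideanSpace ℝ (Fin 2)) :
    ‖x‖ ^ 2 = x 0 ^ 2 + x 1 ^ 2 := by
  simp [EuclideanSpace.norm_sq_eq, Fin.sum_univ_two]

/-- In the plane, the sine of the angle between two vectors is the absolute value of their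
determinant divided by the product of their lengths. -/
theorem EuclideanSpace.sin_angle_mul_norm_mul_norm_sq (v w : EuclideanSpace ℝ (Fin 2)) :
    (Real.sin (InnerProductGeometry.angle v w) * (‖v‖ * ‖w‖)) ^ 2 =
      (v 0 * w 1 - v 1 * w 0) ^ 2 := by
  rw [InnerProductGeometry.sin_angle_mul_norm_mul_norm, Real.sq_sqrt]
  · rw [real_inner_self_eq_norm_sq, real_inner_self_eq_norm_sq, norm_sq_fin_two,
      norm_sq_fin_two]
    simp only [PiLp.inner_apply, Fin.sum_univ_two, RCLike.inner_apply, conj_trivial]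
    ring
  · have := real_inner_mul_inner_self_le v w
    linarith

theorem EuclideanSpace.dist_sq_fin_two (x y : EuclideanSpace ℝ (Fin 2)) :
    dist x y ^ 2 = (x 0 - y 0) ^ 2 + (x 1 - y 1) ^ 2 := by
  rw [EuclideanSpace.dist_eq, Real.sq_sqrt (by positivity), Fin.sum_univ_two, Real.dist_eq,
    Real.dist_eq, sq_abs, sq_abs]

/-- Two nonzero planar vectors with vanishing determinant span the same line. -/
theorem EuclideanSpace.span_eq_of_det_eq_zero {v w : EuclideanSpace ℝ (Fin 2)} (hv : v ≠ 0)
    (hw : w ≠ 0) (h : v 0 * w 1 - v 1 * w 0 = 0) :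
    Submodule.span ℝ {v} = Submodule.span ℝ {w} := by
  have key : ∀ {v w : EuclideanSpace ℝ (Fin 2)}, w ≠ 0 → v 0 * w 1 - v 1 * w 0 = 0 →
      Submodule.span ℝ {v} ≤ Submodule.span ℝ {w} := by
    intro v w hw h
    rw [Submodule.span_singleton_le_iff_mem, Submodule.mem_span_singleton]
    have hn : w 0 ^ 2 + w 1 ^ 2 ≠ 0 := by
      rw [← norm_sq_fin_two]
      exact pow_ne_zero 2 (norm_ne_zero_iff.2 hw)
    refine ⟨(v 0 * w 0 + v 1 * w 1) / (w 0 ^ 2 + w 1 ^ 2), ?_⟩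
    ext i
    rw [PiLp.smul_apply, smul_eq_mul, div_mul_eq_mul_div, div_eq_iff hn]
    fin_cases i
    · simp only [Fin.zero_eta]
      linear_combination -w 1 * h
    · simp only [Fin.mk_one]
      linear_combination w 0 * h
  exact le_antisymm (key hw h) (key hv (by linear_combination -h))

theorem concurrent_lines_motion_concyclic
    (L : Fin 3 → AffineSubspace ℝ (EuclideanSpace ℝ (Fin 2)))
    (hL : ∀ i, IsAffineLine (L i))
    (hdistinct : ∀ i j, i ≠ j → (L i).direction ≠ (L j).direction)
    (p₀ : EuclideanSpace ℝ (Fin 2))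
    (hp₀ : ∀ i, p₀ ∈ L i)
    (v : Fin 3 → EuclideanSpace ℝ (Fin 2))
    (hv : ∀ i, v i ≠ 0 ∧ (L i).direction = Submodule.span ℝ {v i})
    (p : Fin 3 → ℝ → EuclideanSpace ℝ (Fin 2))
    (hcont : ∀ i, Continuous (p i))
    (hmem : ∀ i t, p i t ∈ L i)
    (hrigid : ∀ i j t, dist (p i t) (p j t) = dist (p i 0) (p j 0))
    (hpos : ∀ i j, i ≠ j → 0 < dist (p i 0) (p j 0))
    (hncol : ¬ Collinear ℝ ({p 0 0, p 1 0, p 2 0} : Set (EuclideanSpace ℝ (Fin 2))))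
    (hmove : ∃ i t, p i t ≠ p i 0)
    (α : ℝ) (hα : α = InnerProductGeometry.angle (v 0) (v 1))
    (r : ℝ) (hr : r = dist (p 0 0) (p 1 0) / (2 * Real.sin α)) :
    ∀ t : ℝ, ∃ c : EuclideanSpace ℝ (Fin 2),
      dist p₀ c = r ∧ ∀ i, dist (p i t) c = r := by
  have hn : ∀ i, v i 0 ^ 2 + v i 1 ^ 2 ≠ 0 := fun i => by
    rw [← EuclideanSpace.norm_sq_fin_two]
    exact pow_ne_zero 2 (norm_ne_zero_iff.2 (hv i).1)
  have hD : v 0 0 * v 1 1 - v 0 1 * v 1 0 ≠ 0 := fun h =>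
    hdistinct 0 1 (by decide) (by
      rw [(hv 0).2, (hv 1).2]
      exact EuclideanSpace.span_eq_of_det_eq_zero (hv 0).1 (hv 1).1 h)
  have hex : ∀ i t, ∃ c : ℝ, c • v i = p i t - p₀ := fun i t => by
    have h := AffineSubspace.vsub_mem_direction (hmem i t) (hp₀ i)
    rwa [(hv i).2, Submodule.mem_span_singleton] at h
  choose s hs using hex
  have hco : ∀ i t k, p i t k = p₀ k + s i t * v i k := fun i t k => by
    have := congrArg (fun z : EuclideanSpace ℝ (Fin 2) => z k) (hs i t)
    simp only [PiLp.smul_apply, PiLp.sub_apply, smul_eq_mul] at this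
    linarith
  have hsc : ∀ i, Continuous (s i) := fun i => by
    have h : s i = fun t => ((p i t 0 - p₀ 0) * v i 0 + (p i t 1 - p₀ 1) * v i 1) /
        (v i 0 ^ 2 + v i 1 ^ 2) := by
      funext t
      rw [eq_div_iff (hn i), hco, hco]
      ring
    have := hcont i
    rw [h]
    fun_prop
  have hdist : ∀ i j t, dist (p i t) (p j t) ^ 2 =
      (s i t * v i 0 - s j t * v j 0) ^ 2 + (s i t * v i 1 - s j t * v j 1) ^ 2 :=
    fun i j t => by
      rw [EuclideanSpace.dist_sq_fin_two]
      simp only [hco]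
      ring
  intro t
  obtain ⟨X, hX⟩ : ∃ X, (v 0 0 * v 1 1 - v 0 1 * v 1 0) * X =
      s 0 t * (v 0 0 ^ 2 + v 0 1 ^ 2) * v 1 1 - s 1 t * (v 1 0 ^ 2 + v 1 1 ^ 2) * v 0 1 :=
    ⟨_, mul_div_cancel₀ _ hD⟩
  obtain ⟨Y, hY⟩ : ∃ Y, (v 0 0 * v 1 1 - v 0 1 * v 1 0) * Y =
      s 1 t * (v 1 0 ^ 2 + v 1 1 ^ 2) * v 0 0 - s 0 t * (v 0 0 ^ 2 + v 0 1 ^ 2) * v 1 0 :=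
    ⟨_, mul_div_cancel₀ _ hD⟩
  have hcirc : ∀ i, (s i t * v i 0) ^ 2 + (s i t * v i 1) ^ 2 =
      X * (s i t * v i 0) + Y * (s i t * v i 1) := by
    intro i
    fin_cases i
    · apply mul_left_cancel₀ hD
      simp only [Fin.zero_eta]
      linear_combination -(s 0 t * v 0 0) * hX - (s 0 t * v 0 1) * hY
    · apply mul_left_cancel₀ hD
      simp only [Fin.mk_one]
      linear_combination -(s 1 t * v 1 0) * hX - (s 1 t * v 1 1) * hY
    · refine moving_triangle_on_circle (a := fun i => v i 0) (b := fun i => v i 1) hsc hD hn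
        (fun i j t => ?_) ?_ ?_ t hX hY
      · rw [← hdist, ← hdist, hrigid]
      · rw [← hdist]
        exact pow_ne_zero 2 (hpos 1 0 (by decide)).ne'
      · obtain ⟨i, t, h⟩ := hmove
        refine ⟨i, t, fun hst => h ?_⟩
        ext k
        rw [hco, hco, hst]
  have hsin := EuclideanSpace.sin_angle_mul_norm_mul_norm_sq (v 0) (v 1)
  rw [← hα] at hsin
  have hsin0 : Real.sin α ≠ 0 := fun h => by
    rw [h, zero_mul, zero_pow two_ne_zero] at hsin
    exact hD (pow_eq_zero_iff two_ne_zero |>.1 hsin.symm)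
  have hr0 : 0 ≤ r := by
    rw [hr, hα]
    have := InnerProductGeometry.sin_angle_nonneg (v 0) (v 1)
    positivity
  have hr2 : r ^ 2 = (X / 2) ^ 2 + (Y / 2) ^ 2 := by
    have h01 := hdist 0 1 t
    rw [hrigid] at h01
    rw [mul_pow, mul_pow, EuclideanSpace.norm_sq_fin_two, EuclideanSpace.norm_sq_fin_two] at hsin
    have hsinD : (v 0 0 * v 1 1 - v 0 1 * v 1 0) ^ 2 * (X ^ 2 + Y ^ 2) =
        (v 0 0 ^ 2 + v 0 1 ^ 2) * (v 1 0 ^ 2 + v 1 1 ^ 2) * dist (p 0 0) (p 1 0) ^ 2 := by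
      rw [h01, mul_add, ← mul_pow, ← mul_pow, hX, hY]
      ring
    rw [← hsin] at hsinD
    have : Real.sin α ^ 2 * (X ^ 2 + Y ^ 2) = dist (p 0 0) (p 1 0) ^ 2 := by
      apply mul_left_cancel₀ (mul_ne_zero (hn 0) (hn 1))
      linear_combination hsinD
    rw [hr, div_pow, ← this]
    field_simp
  refine ⟨!₂[p₀ 0 + X / 2, p₀ 1 + Y / 2], ?_, fun i => ?_⟩
  · rw [← sq_eq_sq₀ dist_nonneg hr0, EuclideanSpace.dist_sq_fin_two, hr2]
    simp
  · rw [← sq_eq_sq₀ dist_nonneg hr0, EuclideanSpace.dist_sq_fin_two, hr2, hco, hco]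
    simp only [Matrix.cons_val_zero, Matrix.cons_val_one]
    linear_combination hcirc i
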